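/- For p ≥ 3 and any discrete martingale-difference sequence d_1, …, d_n (with respect to a filtration generated by countable partitions, each d_k bounded), ‖Σ_{k=1}^n d_k‖_p ≤ 2^{1/2} (Γ((p+1)/2)/√π)^{1/p} · ‖𝔖(d)‖_∞, where 𝔖(d) is the Chang–Wilson–Wolff square function. -/

import Mathlib

open MeasureTheory
open ProbabilityTheory
open scoped NNReal

/-- The function `y ↦ |y| ^ q * y` has derivative `(q + 1) * |y| ^ q` for `q ≥ 1`. -/
lemma hasDerivAt_abs_rpow_mul_self {q : ℝ} (hq : 1 ≤ q) (x : ℝ) :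
    HasDerivAt (fun y : ℝ => |y| ^ q * y) ((q + 1) * |x| ^ q) x := by
  rcases eq_or_ne x 0 with rfl | hx
  · have hq0 : q ≠ 0 := by linarith
    have hc : ContinuousAt (fun y : ℝ => |y| ^ q) 0 :=
      (continuous_abs.rpow_const fun _ => Or.inr (by linarith)).continuousAt
    rw [hasDerivAt_iff_tendsto_slope]
    simp only [abs_zero, Real.zero_rpow hq0, mul_zero]
    have h0 : Filter.Tendsto (fun y : ℝ => |y| ^ q) (nhdsWithin 0 {0}ᶜ) (nhds 0) := by
      have := hc.tendsto.mono_left (nhdsWithin_le_nhds (s := {0}ᶜ))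
      simpa [Real.zero_rpow hq0] using this
    refine h0.congr' ?_
    filter_upwards [self_mem_nhdsWithin] with y hy
    have hy : y ≠ 0 := hy
    simp [slope_def_field, hy]
  · have h1 := (hasDerivAt_abs hx).rpow_const (p := q) (Or.inl (abs_ne_zero.mpr hx))
    refine (h1.mul (hasDerivAt_id x)).congr_deriv ?_
    have h2 : |x| ^ q = |x| ^ (q - 1) * |x| := by
      rw [← Real.rpow_add_one (abs_ne_zero.mpr hx)]; ring_nf
    have h3 : (SignType.sign x : ℝ) * x = |x| := by
      simp
    simp only [id, mul_one]
    rw [h2, ← h3]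
    ring

/-- For `q ≥ 1` the function `x ↦ |x| ^ q` is convex. -/
lemma convexOn_abs_rpow {q : ℝ} (hq : 1 ≤ q) :
    ConvexOn ℝ Set.univ (fun x : ℝ => |x| ^ q) := by
  refine ((convexOn_rpow hq).subset (Set.image_subset_iff.2 fun x _ => abs_nonneg x) ?_).comp
    (convexOn_univ_norm (E := ℝ)) ?_
  · exact ((isPreconnected_univ.image _ continuous_norm.continuousOn).ordConnected).convex
  · rintro _ ⟨x, -, rfl⟩ _ ⟨y, -, rfl⟩ h
    exact Real.rpow_le_rpow (abs_nonneg _) h (by linarith)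

lemma monotoneOn_abs_rpow_add_add_abs_rpow_sub {q : ℝ} (hq : 1 ≤ q) (x : ℝ) :
    MonotoneOn (fun t : ℝ => |x + t| ^ q + |x - t| ^ q) (Set.Ici 0) := by
  intro s hs t ht hst
  have hs : 0 ≤ s := hs
  rcases hs.eq_or_lt with rfl | hs0
  · have h := (convexOn_abs_rpow hq).2 (Set.mem_univ (x + t)) (Set.mem_univ (x - t))
      (by norm_num : (0 : ℝ) ≤ 1 / 2) (by norm_num : (0 : ℝ) ≤ 1 / 2) (by norm_num)
    simp only [smul_eq_mul] at h
    rw [show 1 / 2 * (x + t) + 1 / 2 * (x - t) = x by ring] at h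
    simp only [add_zero, sub_zero]
    linarith
  · have ht0 : 0 < t := hs0.trans_le hst
    have ha : 0 ≤ (t + s) / (2 * t) := by positivity
    have hb : 0 ≤ (t - s) / (2 * t) := div_nonneg (by linarith) (by positivity)
    have hab : (t + s) / (2 * t) + (t - s) / (2 * t) = 1 := by field_simp; ring
    have h1 := (convexOn_abs_rpow hq).2 (Set.mem_univ (x + t)) (Set.mem_univ (x - t)) ha hb hab
    have h2 := (convexOn_abs_rpow hq).2 (Set.mem_univ (x - t)) (Set.mem_univ (x + t)) ha hb hab
    simp only [smul_eq_mul] at h1 h2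
    rw [show (t + s) / (2 * t) * (x + t) + (t - s) / (2 * t) * (x - t) = x + s by
      field_simp; ring] at h1
    rw [show (t + s) / (2 * t) * (x - t) + (t - s) / (2 * t) * (x + t) = x - s by
      field_simp; ring] at h2
    have h3 : (t + s) / (2 * t) = 1 - (t - s) / (2 * t) := by linarith
    rw [h3] at h1 h2
    simp only
    linarith

lemma convexOn_abs_rpow_mul_add_sub {q : ℝ} (hq : 1 ≤ q) (x : ℝ) :
    ConvexOn ℝ (Set.Ici 0)
      (fun t : ℝ => |x + t| ^ q * (x + t) - |x - t| ^ q * (x - t)) := by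
  have hd : ∀ t : ℝ, HasDerivAt (fun t : ℝ => |x + t| ^ q * (x + t) - |x - t| ^ q * (x - t))
      ((q + 1) * (|x + t| ^ q + |x - t| ^ q)) t := by
    intro t
    have h1 := (hasDerivAt_abs_rpow_mul_self hq (x + t)).comp t ((hasDerivAt_id t).const_add x)
    have h2 := (hasDerivAt_abs_rpow_mul_self hq (x - t)).comp t ((hasDerivAt_id t).const_sub x)
    exact (h1.sub h2).congr_deriv (by ring)
  refine MonotoneOn.convexOn_of_deriv (convex_Ici 0)
    (fun t _ => (hd t).continuousAt.continuousWithinAt)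
    (fun t _ => (hd t).differentiableAt.differentiableWithinAt) ?_
  rw [interior_Ici]
  intro s hs t ht hst
  rw [(hd s).deriv, (hd t).deriv]
  exact mul_le_mul_of_nonneg_left (monotoneOn_abs_rpow_add_add_abs_rpow_sub hq x
    (Set.Ioi_subset_Ici_self hs) (Set.Ioi_subset_Ici_self ht) hst) (by linarith)

/-- The symmetrisation of `|·| ^ p` around `x` is a convex function of the squared increment. -/
lemma convexOn_abs_rpow_add_sqrt {p : ℝ} (hp : 3 ≤ p) (x : ℝ) :
    ConvexOn ℝ (Set.Ici 0) (fun r : ℝ => |x + √r| ^ p + |x - √r| ^ p) := by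
  set ψ : ℝ → ℝ := fun t => |x + t| ^ (p - 2) * (x + t) - |x - t| ^ (p - 2) * (x - t) with hψ
  have hψc : ConvexOn ℝ (Set.Ici 0) ψ := convexOn_abs_rpow_mul_add_sub (by linarith) x
  have hd : ∀ r : ℝ, 0 < r → HasDerivAt (fun r : ℝ => |x + √r| ^ p + |x - √r| ^ p)
      (p / 2 * (ψ (√r) / √r)) r := by
    intro r hr
    have hs := Real.hasDerivAt_sqrt hr.ne'
    have h1 := (hasDerivAt_abs_rpow (x + √r) (p := p) (by linarith)).comp r (hs.const_add x)
    have h2 := (hasDerivAt_abs_rpow (x - √r) (p := p) (by linarith)).comp r (hs.const_sub x)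
    have hr' : √r ≠ 0 := (Real.sqrt_pos.2 hr).ne'
    refine (h1.add h2).congr_deriv ?_
    simp only [hψ]
    field_simp
    ring
  refine MonotoneOn.convexOn_of_deriv (convex_Ici 0) ?_ ?_ ?_
  · have hp0 : 0 ≤ p := by linarith
    refine Continuous.continuousOn (.add ?_ ?_) <;>
      exact (Continuous.rpow_const (by fun_prop) fun _ => Or.inr hp0)
  · rw [interior_Ici]
    exact fun r hr => (hd r hr).differentiableAt.differentiableWithinAt
  · rw [interior_Ici]
    intro s hs t ht hst
    rw [(hd s hs).deriv, (hd t ht).deriv]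
    have hs' := Real.sqrt_pos.2 hs
    have ht' := Real.sqrt_pos.2 ht
    have h := hψc.secant_mono (a := 0) (x := √s) (y := √t) (Set.self_mem_Ici) hs'.le ht'.le
      hs'.ne' ht'.ne' (Real.sqrt_le_sqrt hst)
    have h0 : ψ 0 = 0 := by simp [hψ]
    simp only [h0, sub_zero] at h
    exact mul_le_mul_of_nonneg_left h (by linarith)

lemma integrable_abs_add_rpow_gaussianReal {p : ℝ} (hp : 0 < p) (x : ℝ) (v : ℝ≥0) :
    Integrable (fun y : ℝ => |x + y| ^ p) (gaussianReal 0 v) := by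
  have h : MemLp (fun y : ℝ => x + y) (ENNReal.ofReal p) (gaussianReal 0 v) :=
    (memLp_const x).add (memLp_id_gaussianReal' _ ENNReal.ofReal_ne_top)
  have h2 := h.integrable_norm_rpow (by simpa using hp) ENNReal.ofReal_ne_top
  simpa [ENNReal.toReal_ofReal hp.le] using h2

/-- The `p`-th absolute moment of a Gaussian variable with mean `x` and variance `v`. -/
noncomputable def gaussianAbsMoment (p x : ℝ) (v : ℝ≥0) : ℝ :=
  ∫ y, |x + y| ^ p ∂(gaussianReal 0 v)

lemma gaussianAbsMoment_nonneg (p x : ℝ) (v : ℝ≥0) : 0 ≤ gaussianAbsMoment p x v :=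
  integral_nonneg fun _ => Real.rpow_nonneg (abs_nonneg _) _

lemma gaussianAbsMoment_zero_right (p x : ℝ) : gaussianAbsMoment p x 0 = |x| ^ p := by
  simp [gaussianAbsMoment, gaussianReal_zero_var]

lemma convexOn_gaussianAbsMoment {p : ℝ} (hp : 1 ≤ p) (v : ℝ≥0) :
    ConvexOn ℝ Set.univ (fun x => gaussianAbsMoment p x v) := by
  have hp0 : 0 < p := by linarith
  refine ⟨convex_univ, fun x _ y _ a b ha hb hab => ?_⟩
  simp only [gaussianAbsMoment, smul_eq_mul]
  rw [← integral_const_mul, ← integral_const_mul, ← integral_add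
    ((integrable_abs_add_rpow_gaussianReal hp0 x v).const_mul a)
    ((integrable_abs_add_rpow_gaussianReal hp0 y v).const_mul b)]
  refine integral_mono (integrable_abs_add_rpow_gaussianReal hp0 _ v)
    (((integrable_abs_add_rpow_gaussianReal hp0 x v).const_mul a).add
    ((integrable_abs_add_rpow_gaussianReal hp0 y v).const_mul b)) fun z => ?_
  have h := (convexOn_abs_rpow hp).2 (Set.mem_univ (x + z)) (Set.mem_univ (y + z)) ha hb hab
  simp only [smul_eq_mul] at h
  rwa [show a * (x + z) + b * (y + z) = a * x + b * y + z by linear_combination z * hab] at h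

lemma integral_sq_gaussianReal (v : ℝ≥0) : ∫ y, y ^ 2 ∂(gaussianReal 0 v) = v := by
  have h := variance_fun_id_gaussianReal (μ := 0) (v := v)
  rw [variance_eq_integral (by fun_prop)] at h
  simpa using h

lemma integrable_sq_gaussianReal (v : ℝ≥0) :
    Integrable (fun y : ℝ => y ^ 2) (gaussianReal 0 v) :=
  (memLp_id_gaussianReal' 2 (by simp)).integrable_sq

lemma gaussianAbsMoment_eq_integral_sub (p x : ℝ) (v : ℝ≥0) :
    gaussianAbsMoment p x v = ∫ y, |x - y| ^ p ∂(gaussianReal 0 v) := by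
  have h := gaussianReal_map_neg (μ := 0) (v := v)
  rw [neg_zero] at h
  rw [gaussianAbsMoment]
  conv_lhs => rw [← h]
  rw [integral_map (by fun_prop) (Measurable.aestronglyMeasurable (by fun_prop))]
  simp [sub_eq_add_neg]

/-- A symmetric two-point perturbation has smaller `p`-th absolute moments than a Gaussian
perturbation of the same variance. -/
lemma abs_rpow_add_abs_rpow_le_gaussianAbsMoment {p : ℝ} (hp : 3 ≤ p) (x : ℝ) (v : ℝ≥0) :
    |x + √v| ^ p + |x - √v| ^ p ≤ 2 * gaussianAbsMoment p x v := by
  have hp0 : 0 < p := by linarith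
  have hplus := integrable_abs_add_rpow_gaussianReal hp0 x v
  have hminus : Integrable (fun y : ℝ => |x - y| ^ p) (gaussianReal 0 v) := by
    have h := integrable_abs_add_rpow_gaussianReal hp0 x v
    have hn := gaussianReal_map_neg (μ := 0) (v := v)
    rw [neg_zero] at hn
    rw [← hn, integrable_map_measure (Measurable.aestronglyMeasurable (by fun_prop))
      (by fun_prop)] at h
    simpa [Function.comp_def, sub_eq_add_neg] using h
  have heq : (fun r : ℝ => |x + √r| ^ p + |x - √r| ^ p) ∘ (fun y : ℝ => y ^ 2) =
      fun y => |x + y| ^ p + |x - y| ^ p := by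
    funext y
    simp only [Function.comp, Real.sqrt_sq_eq_abs]
    rcases abs_cases y with h | h
    · rw [h.1]
    · rw [h.1, sub_neg_eq_add, ← sub_eq_add_neg, add_comm]
  have hcont : ContinuousOn (fun r : ℝ => |x + √r| ^ p + |x - √r| ^ p) (Set.Ici 0) := by
    refine Continuous.continuousOn (.add ?_ ?_) <;>
      exact (Continuous.rpow_const (by fun_prop) fun _ => Or.inr hp0.le)
  have hJ := (convexOn_abs_rpow_add_sqrt hp x).map_integral_le (μ := gaussianReal 0 v)
    (f := fun y : ℝ => y ^ 2) hcont isClosed_Ici (ae_of_all _ fun y => sq_nonneg y)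
    (integrable_sq_gaussianReal v) (by rw [heq]; exact hplus.add hminus)
  rw [integral_sq_gaussianReal] at hJ
  refine hJ.trans_eq ?_
  have heq' := fun y => congrFun heq y
  simp only [Function.comp] at heq'
  simp only [heq']
  rw [integral_add hplus hminus, ← gaussianAbsMoment_eq_integral_sub, ← gaussianAbsMoment]
  ring

lemma gaussianAbsMoment_add_right {p : ℝ} (hp : 0 < p) (x : ℝ) (v w : ℝ≥0) :
    gaussianAbsMoment p x (v + w) = ∫ y, gaussianAbsMoment p (x + y) w ∂(gaussianReal 0 v) ∧
      Integrable (fun y => gaussianAbsMoment p (x + y) w) (gaussianReal 0 v) := by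
  have hc : gaussianReal 0 v ∗ gaussianReal 0 w = gaussianReal 0 (v + w) := by
    rw [gaussianReal_conv_gaussianReal, add_zero]
  have hi := integrable_abs_add_rpow_gaussianReal hp x (v + w)
  rw [← hc] at hi
  constructor
  · simp only [gaussianAbsMoment]
    rw [← hc, integral_conv hi]
    simp only [add_assoc]
  · rw [Measure.conv, integrable_map_measure (Measurable.aestronglyMeasurable (by fun_prop))
      (by fun_prop)] at hi
    simpa [gaussianAbsMoment, Function.comp_def, add_assoc] using hi.integral_prod_left

lemma gaussianAbsMoment_add_sub_le {p : ℝ} (hp : 3 ≤ p) (x : ℝ) (v w : ℝ≥0) :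
    gaussianAbsMoment p (x + √w) v + gaussianAbsMoment p (x - √w) v ≤
      2 * gaussianAbsMoment p x (v + w) := by
  have hp0 : 0 < p := by linarith
  obtain ⟨h1, h2⟩ := gaussianAbsMoment_add_right hp0 x v w
  rw [h1, gaussianAbsMoment, gaussianAbsMoment, ← integral_const_mul, ← integral_add
    (integrable_abs_add_rpow_gaussianReal hp0 _ v) (integrable_abs_add_rpow_gaussianReal hp0 _ v)]
  refine integral_mono ((integrable_abs_add_rpow_gaussianReal hp0 _ v).add
    (integrable_abs_add_rpow_gaussianReal hp0 _ v)) (h2.const_mul 2) fun y => ?_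
  have h := abs_rpow_add_abs_rpow_le_gaussianAbsMoment hp (x + y) w
  simp only
  rwa [show x + √w + y = x + y + √w by ring, show x - √w + y = x + y - √w by ring]

lemma gaussianAbsMoment_mono_right {p : ℝ} (hp : 3 ≤ p) (x : ℝ) :
    Monotone (gaussianAbsMoment p x) := by
  intro v w hvw
  obtain ⟨u, rfl⟩ := exists_add_of_le hvw
  have h1 := gaussianAbsMoment_add_sub_le hp x v u
  have h2 := (convexOn_gaussianAbsMoment (p := p) (by linarith) v).2 (Set.mem_univ (x + √u))
    (Set.mem_univ (x - √u)) (by norm_num : (0 : ℝ) ≤ 1 / 2) (by norm_num : (0 : ℝ) ≤ 1 / 2)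
    (by norm_num)
  simp only [smul_eq_mul] at h2
  rw [show 1 / 2 * (x + √u) + 1 / 2 * (x - √u) = x by ring] at h2
  linarith

lemma gaussianAbsMoment_le_of_abs_le {p C x : ℝ} (hp : 3 ≤ p) (hx : |x| ≤ C) {v w : ℝ≥0}
    (hvw : v ≤ w) :
    gaussianAbsMoment p x v ≤ max (gaussianAbsMoment p (-C) w) (gaussianAbsMoment p C w) :=
  (gaussianAbsMoment_mono_right hp x hvw).trans
    ((convexOn_gaussianAbsMoment (p := p) (by linarith) w).le_max_of_mem_Icc
      (Set.mem_univ _) (Set.mem_univ _) (abs_le.1 hx))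

/-- One step of the comparison: an increment bounded by `D` is dominated, up to a linear term, by
a Gaussian increment of variance `D ^ 2`. -/
lemma gaussianAbsMoment_add_le {p D δ : ℝ} (hp : 3 ≤ p) (hδ : |δ| ≤ D) (a : ℝ) (v : ℝ≥0) :
    gaussianAbsMoment p (a + δ) v ≤ gaussianAbsMoment p a (v + (D ^ 2).toNNReal) +
      (gaussianAbsMoment p (a + D) v - gaussianAbsMoment p (a - D) v) / (2 * D) * δ := by
  have hD : 0 ≤ D := (abs_nonneg δ).trans hδ
  have h1 := gaussianAbsMoment_add_sub_le hp a v (D ^ 2).toNNReal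
  rw [Real.coe_toNNReal _ (sq_nonneg D), Real.sqrt_sq hD] at h1
  obtain ⟨hl, hu⟩ := abs_le.1 hδ
  rcases hD.eq_or_lt with rfl | hD0
  · obtain rfl : δ = 0 := by linarith
    simp
  · have hα : 0 ≤ (D + δ) / (2 * D) := div_nonneg (by linarith) (by linarith)
    have hβ : 0 ≤ (D - δ) / (2 * D) := div_nonneg (by linarith) (by linarith)
    have h2 := (convexOn_gaussianAbsMoment (p := p) (by linarith) v).2 (Set.mem_univ (a + D))
      (Set.mem_univ (a - D)) hα hβ (by field_simp; ring)
    simp only [smul_eq_mul] at h2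
    rw [show (D + δ) / (2 * D) * (a + D) + (D - δ) / (2 * D) * (a - D) = a + δ by
      field_simp; ring] at h2
    have h3 : (D + δ) / (2 * D) * gaussianAbsMoment p (a + D) v +
        (D - δ) / (2 * D) * gaussianAbsMoment p (a - D) v =
        (gaussianAbsMoment p (a + D) v + gaussianAbsMoment p (a - D) v) / 2 +
        (gaussianAbsMoment p (a + D) v - gaussianAbsMoment p (a - D) v) / (2 * D) * δ := by
      field_simp; ring
    linarith

lemma gaussianAbsMoment_zero_left {p : ℝ} (hp : 0 < p) {M : ℝ} (hM : 0 < M) :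
    gaussianAbsMoment p 0 (M ^ 2).toNNReal =
      M ^ p * (2 ^ (p / 2) * (Real.Gamma ((p + 1) / 2) / √Real.pi)) := by
  have hv : (M ^ 2).toNNReal ≠ 0 := by simpa using hM.ne'
  have hπ := Real.pi_pos
  have hb : 0 < 1 / (2 * M ^ 2) := by positivity
  rw [gaussianAbsMoment, integral_gaussianReal_eq_integral_smul hv]
  simp only [gaussianPDFReal_def, Real.coe_toNNReal _ (sq_nonneg M), smul_eq_mul, zero_add,
    sub_zero]
  have h1 : ∀ y : ℝ, (√(2 * Real.pi * M ^ 2))⁻¹ * Real.exp (-y ^ 2 / (2 * M ^ 2)) * |y| ^ p =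
      (√(2 * Real.pi * M ^ 2))⁻¹ * (fun t : ℝ => t ^ p *
        Real.exp (-(1 / (2 * M ^ 2)) * t ^ (2 : ℝ))) |y| := by
    intro y
    simp only [Real.rpow_two, sq_abs]
    rw [show -(1 / (2 * M ^ 2)) * y ^ 2 = -y ^ 2 / (2 * M ^ 2) by ring]
    ring
  simp only [h1]
  rw [integral_const_mul, integral_comp_abs (f := fun t : ℝ => t ^ p *
    Real.exp (-(1 / (2 * M ^ 2)) * t ^ (2 : ℝ))), integral_rpow_mul_exp_neg_mul_rpow two_pos
    (by linarith) hb]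
  have h2 : (1 / (2 * M ^ 2)) ^ (-(p + 1) / 2) = 2 ^ (p / 2) * √2 * (M ^ p * M) := by
    rw [one_div, Real.inv_rpow (by positivity), ← Real.rpow_neg (by positivity),
      Real.mul_rpow (by norm_num) (by positivity), ← Real.rpow_natCast M 2,
      ← Real.rpow_mul hM.le, Real.sqrt_eq_rpow, ← Real.rpow_add two_pos, ← Real.rpow_add_one hM.ne']
    congr 2 <;> push_cast <;> ring
  have h3 : √(2 * Real.pi * M ^ 2) = √2 * √Real.pi * M := by
    rw [Real.sqrt_mul (by positivity), Real.sqrt_mul (by norm_num), Real.sqrt_sq hM.le]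
  rw [h2, h3]
  have : √Real.pi ≠ 0 := by positivity
  field_simp

lemma measurable_of_eq_on_partition {Ω : Type*} [MeasurableSpace Ω] {P : ℕ → Set Ω}
    (hP : ∀ i, MeasurableSet (P i)) (hcover : (⋃ i, P i) = Set.univ) {f : Ω → ℝ}
    (hf : ∀ i, ∀ x ∈ P i, ∀ y ∈ P i, f x = f y) : Measurable f := by
  intro B _
  have h : f ⁻¹' B = ⋃ i ∈ {i | ∃ x ∈ P i, f x ∈ B}, P i := by
    ext x
    simp only [Set.mem_preimage, Set.mem_iUnion, Set.mem_ofPred_eq, exists_prop]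
    constructor
    · intro hx
      obtain ⟨i, hi⟩ := Set.mem_iUnion.1 (hcover ▸ Set.mem_univ x)
      exact ⟨i, ⟨x, hi, hx⟩, hi⟩
    · rintro ⟨i, ⟨y, hy, hyB⟩, hx⟩
      rwa [hf i x hx y hy]
  rw [h]
  exact MeasurableSet.biUnion (Set.to_countable _) fun i _ => hP i

lemma integral_le_integral_of_partition {Ω : Type*} [MeasurableSpace Ω] {μ : Measure Ω}
    {P : ℕ → Set Ω} (hP : ∀ i, MeasurableSet (P i))
    (hdisj : Pairwise fun i j => Disjoint (P i) (P j)) (hcover : (⋃ i, P i) = Set.univ)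
    {f g : Ω → ℝ} (hf : Integrable f μ) (hg : Integrable g μ)
    (h : ∀ i, ∫ x in P i, f x ∂μ ≤ ∫ x in P i, g x ∂μ) : ∫ x, f x ∂μ ≤ ∫ x, g x ∂μ := by
  have h1 := hasSum_integral_iUnion hP hdisj hf.integrableOn
  have h2 := hasSum_integral_iUnion hP hdisj hg.integrableOn
  rw [hcover, setIntegral_univ] at h1 h2
  exact hasSum_le h h1 h2

/-- Moment comparison for martingale differences `d k` dominated by `D k`, where `D k` is constant
on the atoms of the `k`-th partition. -/
lemma integral_abs_sum_rpow_le_gaussianAbsMoment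
    {Ω : Type*} [MeasurableSpace Ω] (μ : Measure Ω) [IsProbabilityMeasure μ]
    (n : ℕ) {p : ℝ} (hp : 3 ≤ p) {part : ℕ → ℕ → Set Ω}
    (hmeas : ∀ k i, MeasurableSet (part k i))
    (hdisj : ∀ k, Pairwise fun i j => Disjoint (part k i) (part k j))
    (hcover : ∀ k, (⋃ i, part k i) = Set.univ)
    (hrefine : ∀ k i, ∃ j, part (k + 1) i ⊆ part k j)
    {d D : ℕ → Ω → ℝ}
    (hbdd : ∀ k, ∃ C : ℝ, ∀ x, |d k x| ≤ C)
    (hadapted : ∀ k i, ∀ x ∈ part (k + 1) i, ∀ y ∈ part (k + 1) i, d k x = d k y)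
    (hmart : ∀ k i, ∫ x in part k i, d k x ∂μ = 0)
    (hpred : ∀ k i, ∀ x ∈ part k i, ∀ y ∈ part k i, D k x = D k y)
    (hdD : ∀ k x, |d k x| ≤ D k x)
    {v : ℝ≥0} (hSq : ∀ᵐ x ∂μ, ∑ k ∈ Finset.range n, D k x ^ 2 ≤ v) :
    ∫ x, |∑ k ∈ Finset.range n, d k x| ^ p ∂μ ≤ gaussianAbsMoment p 0 v := by
  have hsub : ∀ j m i, ∃ i', part (j + m) i ⊆ part j i' := by
    intro j m
    induction m with
    | zero => exact fun i => ⟨i, subset_rfl⟩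
    | succ m ih =>
      intro i
      obtain ⟨i₁, h₁⟩ := hrefine (j + m) i
      obtain ⟨i₂, h₂⟩ := ih i₁
      exact ⟨i₂, h₁.trans h₂⟩
  have hsub' : ∀ {j k}, j ≤ k → ∀ i, ∃ i', part k i ⊆ part j i' := by
    intro j k hjk i
    obtain ⟨m, rfl⟩ := Nat.exists_eq_add_of_le hjk
    exact hsub j m i
  have hd_const : ∀ {j k}, j < k → ∀ i, ∀ x ∈ part k i, ∀ y ∈ part k i, d j x = d j y := by
    intro j k hjk i x hx y hy
    obtain ⟨i', hi'⟩ := hsub' (Nat.succ_le_of_lt hjk) i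
    exact hadapted j i' x (hi' hx) y (hi' hy)
  have hD_const : ∀ {j k}, j ≤ k → ∀ i, ∀ x ∈ part k i, ∀ y ∈ part k i, D j x = D j y := by
    intro j k hjk i x hx y hy
    obtain ⟨i', hi'⟩ := hsub' hjk i
    exact hpred j i' x (hi' hx) y (hi' hy)
  set X : ℕ → Ω → ℝ := fun k x => ∑ j ∈ Finset.range k, d j x with hX
  set V : ℕ → Ω → ℝ≥0 := fun k x => (v - ∑ j ∈ Finset.range k, D j x ^ 2 : ℝ).toNNReal with hV
  set F : ℕ → Ω → ℝ := fun k x => gaussianAbsMoment p (X k x) (V k x) with hF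
  have hX_const : ∀ k i, ∀ x ∈ part k i, ∀ y ∈ part k i, X k x = X k y :=
    fun k i x hx y hy => Finset.sum_congr rfl fun j hj =>
      hd_const (Finset.mem_range.1 hj) i x hx y hy
  have hV_const : ∀ k i, ∀ x ∈ part k i, ∀ y ∈ part k i, V k x = V k y := by
    intro k i x hx y hy
    simp only [hV]
    rw [Finset.sum_congr rfl fun j hj => by
      rw [hD_const (Finset.mem_range.1 hj).le i x hx y hy]]
  have hF_int : ∀ k, Integrable (F k) μ := by
    intro k
    choose C hC using hbdd
    have hXb : ∀ x, |X k x| ≤ ∑ j ∈ Finset.range k, C j := fun x =>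
      (Finset.abs_sum_le_sum_abs _ _).trans (Finset.sum_le_sum fun j _ => hC j x)
    have hVb : ∀ x, V k x ≤ v := fun x => by
      rw [hV, Real.toNNReal_le_iff_le_coe]
      exact sub_le_self _ (Finset.sum_nonneg fun j _ => sq_nonneg _)
    refine Integrable.of_bound (measurable_of_eq_on_partition (hmeas k) (hcover k)
      fun i x hx y hy => ?_).aestronglyMeasurable
      (max (gaussianAbsMoment p (-∑ j ∈ Finset.range k, C j) v)
        (gaussianAbsMoment p (∑ j ∈ Finset.range k, C j) v))
      (ae_of_all _ fun x => ?_)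
    · simp only [hF, hX_const k i x hx y hy, hV_const k i x hx y hy]
    · rw [Real.norm_of_nonneg (gaussianAbsMoment_nonneg _ _ _)]
      exact gaussianAbsMoment_le_of_abs_le hp (hXb x) (hVb x)
  have hd_int : ∀ k, Integrable (d k) μ := by
    intro k
    obtain ⟨C, hC⟩ := hbdd k
    exact Integrable.of_bound (measurable_of_eq_on_partition (hmeas (k + 1)) (hcover (k + 1))
      (hadapted k)).aestronglyMeasurable C (ae_of_all _ hC)
  have hstep : ∀ k < n, ∫ x, F (k + 1) x ∂μ ≤ ∫ x, F k x ∂μ := by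
    intro k hk
    refine integral_le_integral_of_partition (hmeas k) (hdisj k) (hcover k)
      (hF_int _) (hF_int _) fun i => ?_
    by_cases hμ : μ (part k i) = 0
    · rw [Measure.restrict_eq_zero.2 hμ, integral_zero_measure, integral_zero_measure]
    obtain ⟨x₀, hx₀, hS⟩ : ∃ x ∈ part k i, ∑ j ∈ Finset.range n, D j x ^ 2 ≤ v := by
      by_contra! hcon
      exact hμ (measure_mono_null (fun x hx => (hcon x hx).not_ge) (ae_iff.1 hSq))
    have hS' : ∑ j ∈ Finset.range (k + 1), D j x₀ ^ 2 ≤ v :=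
      (Finset.sum_le_sum_of_subset_of_nonneg (Finset.range_mono hk)
        fun j _ _ => sq_nonneg _).trans hS
    have hVx : V k x₀ = V (k + 1) x₀ + (D k x₀ ^ 2).toNNReal := by
      simp only [hV]
      rw [← Real.toNNReal_add (sub_nonneg.2 hS') (sq_nonneg _), Finset.sum_range_succ]
      congr 1
      ring
    set c : ℝ := (gaussianAbsMoment p (X k x₀ + D k x₀) (V (k + 1) x₀) -
      gaussianAbsMoment p (X k x₀ - D k x₀) (V (k + 1) x₀)) / (2 * D k x₀) with hc
    have hpt : ∀ y ∈ part k i, F (k + 1) y ≤ F k y + c * d k y := by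
      intro y hy
      have hV1 : V (k + 1) y = V (k + 1) x₀ := by
        simp only [hV]
        rw [Finset.sum_congr rfl fun j hj => by
          rw [hD_const (Nat.lt_succ_iff.1 (Finset.mem_range.1 hj)) i y hy x₀ hx₀]]
      have hX1 : X (k + 1) y = X k x₀ + d k y := by
        rw [← hX_const k i y hy x₀ hx₀, hX]
        exact Finset.sum_range_succ _ _
      have hb : |d k y| ≤ D k x₀ := hD_const le_rfl i y hy x₀ hx₀ ▸ hdD k y
      simp only [hF]
      rw [hV1, hX1, hX_const k i y hy x₀ hx₀, hV_const k i y hy x₀ hx₀, hVx]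
      exact gaussianAbsMoment_add_le hp hb _ _
    calc ∫ x in part k i, F (k + 1) x ∂μ
        ≤ ∫ x in part k i, (F k x + c * d k x) ∂μ :=
          setIntegral_mono_on (hF_int _).integrableOn
            ((hF_int k).add ((hd_int k).const_mul c)).integrableOn (hmeas k i) hpt
      _ = ∫ x in part k i, F k x ∂μ := by
          rw [integral_add (hF_int k).integrableOn ((hd_int k).const_mul c).integrableOn,
            integral_const_mul, hmart, mul_zero, add_zero]
  have hchain : ∀ k ≤ n, ∫ x, F k x ∂μ ≤ gaussianAbsMoment p 0 v := by
    intro k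
    induction k with
    | zero => intro _; simp [hF, hX, hV]
    | succ k ih => exact fun hk => (hstep k hk).trans (ih (Nat.le_of_succ_le hk))
  refine le_trans ?_ (hchain n le_rfl)
  refine integral_mono_of_nonneg (ae_of_all _ fun x => Real.rpow_nonneg (abs_nonneg _) _)
    (hF_int n) (ae_of_all _ fun x => ?_)
  have h := gaussianAbsMoment_mono_right hp (X n x) (zero_le : 0 ≤ V n x)
  rwa [gaussianAbsMoment_zero_right] at h

/-- Khintchine-type inequality with the Gaussian constant for discrete
martingale differences: for `p ≥ 3`,
`‖Σ d_k‖_p ≤ 2^(1/2) (Γ((p+1)/2)/√π)^(1/p) ‖𝔖(d)‖_∞`.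
(Setup as in the paper: discrete filtration generated by countable partitions,
bounded martingale differences, a.e. bound `M` on the square function.) -/
theorem stmt_14
    {Ω : Type*} [MeasurableSpace Ω] (μ : Measure Ω) [IsProbabilityMeasure μ]
    (n : ℕ) (hn : 0 < n) (p : ℝ) (hp : 3 ≤ p)
    (part : ℕ → ℕ → Set Ω)
    (hpart_meas : ∀ k i, MeasurableSet (part k i))
    (hpart_disj : ∀ k, Pairwise fun i j => Disjoint (part k i) (part k j))
    (hpart_cover : ∀ k, (⋃ i, part k i) = Set.univ)
    (hpart_zero : part 0 0 = Set.univ)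
    (hpart_refine : ∀ k i, ∃ j, part (k + 1) i ⊆ part k j)
    (d : Fin n → Ω → ℝ)
    (hd_meas : ∀ k, Measurable (d k))
    (hd_bdd : ∀ k, ∃ C : ℝ, ∀ x, |d k x| ≤ C)
    (hd_adapted : ∀ (k : Fin n) (i : ℕ), ∀ x ∈ part (k.1 + 1) i, ∀ y ∈ part (k.1 + 1) i,
      d k x = d k y)
    (hd_mart : ∀ (k : Fin n) (i : ℕ), ∫ x in part k.1 i, d k x ∂μ = 0)
    (M : ℝ) (hM : 0 < M)
    (hSq : ∀ᵐ x ∂μ, ∀ i : ℕ → ℕ, (∀ k : Fin n, x ∈ part k.1 (i k.1)) →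
      ∑ k : Fin n, (sSup ((fun y => |d k y|) '' part k.1 (i k.1))) ^ 2 ≤ M ^ 2) :
    (∫ x, |∑ k, d k x| ^ p ∂μ) ^ (1 / p) ≤
      Real.sqrt 2 * (Real.Gamma ((p + 1) / 2) / Real.sqrt Real.pi) ^ (1 / p) * M := by
  have hp0 : 0 < p := by linarith
  have hex : ∀ k x, ∃ i, x ∈ part k i := fun k x =>
    Set.mem_iUnion.1 (hpart_cover k ▸ Set.mem_univ x)
  choose idx hidx using hex
  have hidx_eq : ∀ k i, ∀ x ∈ part k i, idx k x = i := fun k i x hx => by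
    by_contra hne
    exact Set.disjoint_left.1 (hpart_disj k hne) (hidx k x) hx
  set e : ℕ → Ω → ℝ := fun k => if h : k < n then d ⟨k, h⟩ else 0 with he
  have he_lt : ∀ k : Fin n, e k = d k := fun k => by simp [he]
  have he_cases : ∀ k, (∃ j : Fin n, j.1 = k ∧ e k = d j) ∨ e k = 0 := fun k => by
    by_cases h : k < n
    · exact Or.inl ⟨⟨k, h⟩, rfl, he_lt ⟨k, h⟩⟩
    · exact Or.inr (by simp [he, h])
  have hbdd : ∀ k, ∃ C : ℝ, ∀ x, |e k x| ≤ C := fun k => by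
    rcases he_cases k with ⟨j, rfl, h⟩ | h
    · exact h ▸ hd_bdd j
    · exact ⟨0, fun x => by simp [h]⟩
  set D : ℕ → Ω → ℝ := fun k x => sSup ((fun y => |e k y|) '' part k (idx k x)) with hD
  have key := integral_abs_sum_rpow_le_gaussianAbsMoment μ n hp hpart_meas hpart_disj hpart_cover
    hpart_refine (d := e) (D := D) (v := (M ^ 2).toNNReal) hbdd
    (fun k i x hx y hy => by
      rcases he_cases k with ⟨j, rfl, h⟩ | h
      · exact h ▸ hd_adapted j i x hx y hy
      · simp [h])
    (fun k i => by
      rcases he_cases k with ⟨j, rfl, h⟩ | h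
      · exact h ▸ hd_mart j i
      · simp [h])
    (fun k i x hx y hy => by simp only [hD, hidx_eq k i x hx, hidx_eq k i y hy])
    (fun k x => by
      obtain ⟨C, hC⟩ := hbdd k
      exact le_csSup ⟨C, by rintro _ ⟨y, -, rfl⟩; exact hC y⟩ ⟨x, hidx k x, rfl⟩)
    (by
      filter_upwards [hSq] with x hx
      have h := hx (fun k => idx k x) fun k => hidx k x
      rw [Real.coe_toNNReal _ (sq_nonneg M), Finset.sum_range]
      simpa only [hD, he_lt] using h)
  rw [gaussianAbsMoment_zero_left hp0 hM] at key
  simp only [Finset.sum_range, he_lt] at key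
  have hΓ : 0 ≤ Real.Gamma ((p + 1) / 2) / √Real.pi :=
    div_nonneg (Real.Gamma_pos_of_pos (by linarith)).le (Real.sqrt_nonneg _)
  have h1 := Real.rpow_le_rpow
    (integral_nonneg fun x => Real.rpow_nonneg (abs_nonneg _) p) key (one_div_pos.2 hp0).le
  refine h1.trans_eq ?_
  rw [Real.mul_rpow (by positivity) (by positivity), Real.mul_rpow (by positivity) hΓ,
    ← Real.rpow_mul hM.le, ← Real.rpow_mul two_pos.le, mul_one_div_cancel hp0.ne', Real.rpow_one,
    Real.sqrt_eq_rpow 2, show p / 2 * (1 / p) = 1 / 2 by field_simp]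
  ring
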